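/- arXiv:2408.07914 — 2 statements merged into one kernel-verified Lean document; each statement's English description precedes it below -/
import Mathlib

section
/- Let X be an n × d random matrix with iid N(0,1) entries, with n ≥ d + 2. Then XᵀX is almost surely invertible and E[trace((XᵀX)⁻¹)] = d/(n - d - 1). -/
open MeasureTheory ProbabilityTheory Matrix

noncomputable section

lemma aux_gauss1 (t : ℝ) (ht : 0 ≤ t) :
    ∫ x, Real.exp (-t * x ^ 2) ∂(gaussianReal 0 1) = (1 + 2 * t) ^ (-(1 / 2) : ℝ) := by
  rw [integral_gaussianReal_eq_integral_smul (by norm_num)]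
  have h : ∀ x : ℝ, gaussianPDFReal 0 1 x • Real.exp (-t * x ^ 2) =
      (√(2 * Real.pi))⁻¹ * Real.exp (-(t + 1 / 2) * x ^ 2) := by
    intro x
    simp only [gaussianPDFReal, NNReal.coe_one, mul_one, sub_zero, smul_eq_mul]
    rw [mul_assoc, ← Real.exp_add]
    congr 2
    ring
  simp_rw [h]
  rw [integral_const_mul, integral_gaussian, ← Real.sqrt_inv, ← Real.sqrt_mul (by positivity),
    Real.rpow_neg (by positivity), ← Real.sqrt_eq_rpow, ← Real.sqrt_inv]
  congr 1
  have := Real.pi_pos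
  have : t + 1 / 2 ≠ 0 := by positivity
  have : 1 + 2 * t ≠ 0 := by positivity
  field_simp
  ring

lemma aux_gaussE {E : Type*} [NormedAddCommGroup E] [InnerProductSpace ℝ E]
    [FiniteDimensional ℝ E] [MeasurableSpace E] [BorelSpace E] (t : ℝ) (ht : 0 ≤ t) :
    ∫⁻ g, ENNReal.ofReal (Real.exp (-t * ‖g‖ ^ 2)) ∂(stdGaussian E) =
      ENNReal.ofReal ((1 + 2 * t) ^ (-(Module.finrank ℝ E / 2 : ℝ))) := by
  rw [← ofReal_integral_eq_lintegral_ofReal]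
  · congr 1
    rw [stdGaussian, integral_map (Measurable.aemeasurable (by fun_prop))
      (Measurable.aestronglyMeasurable (by fun_prop))]
    have h : ∀ x : Fin (Module.finrank ℝ E) → ℝ,
        Real.exp (-t * ‖∑ i, x i • stdOrthonormalBasis ℝ E i‖ ^ 2) =
        ∏ i, Real.exp (-t * x i ^ 2) := by
      intro x
      rw [← Real.exp_sum, ← Finset.mul_sum, ← real_inner_self_eq_norm_sq,
        (stdOrthonormalBasis ℝ E).orthonormal.inner_sum]
      simp [pow_two]
    simp_rw [h]
    rw [integral_fintype_prod_eq_prod (f := fun _ (x : ℝ) => Real.exp (-t * x ^ 2))]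
    simp_rw [aux_gauss1 t ht]
    rw [Finset.prod_const, ← Real.rpow_natCast, ← Real.rpow_mul (by positivity)]
    simp
    ring_nf
  · refine Integrable.of_bound (C := 1) (Measurable.aestronglyMeasurable (by fun_prop)) ?_
    refine Filter.Eventually.of_forall fun g => ?_
    rw [Real.norm_eq_abs, abs_of_pos (Real.exp_pos _), Real.exp_le_one_iff]
    have : 0 ≤ t * ‖g‖ ^ 2 := by positivity
    linarith
  · exact Filter.Eventually.of_forall fun g => (Real.exp_pos _).le

lemma aux_laplace (s : ℝ) (hs : 0 ≤ s) :
    ∫⁻ t in Set.Ioi (0 : ℝ), ENNReal.ofReal (Real.exp (-t * s)) = (ENNReal.ofReal s)⁻¹ := by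
  rcases hs.eq_or_lt with rfl | hs
  · simp
  · have h : ∀ t : ℝ, -t * s = (-s) * t := fun t => by ring
    simp_rw [h]
    rw [← ofReal_integral_eq_lintegral_ofReal (integrableOn_exp_mul_Ioi (by linarith) 0)
      (Filter.Eventually.of_forall fun g => (Real.exp_pos _).le),
      integral_exp_mul_Ioi (by linarith) 0, ← ENNReal.ofReal_inv_of_pos hs]
    congr 1
    simp

lemma aux_pow (k : ℕ) (hk : 3 ≤ k) :
    ∫⁻ t in Set.Ioi (0 : ℝ), ENNReal.ofReal ((1 + 2 * t) ^ (-(k / 2 : ℝ))) =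
      ENNReal.ofReal (1 / ((k : ℝ) - 2)) := by
  have hk' : (3 : ℝ) ≤ k := by exact_mod_cast hk
  have hd : ∀ x ∈ Set.Ici (0 : ℝ), HasDerivAt
      (fun t : ℝ => -(1 / ((k : ℝ) - 2)) * (1 + 2 * t) ^ (-((k : ℝ) / 2 - 1)))
      ((1 + 2 * x) ^ (-(k / 2 : ℝ))) x := by
    intro x hx
    have hx : 0 ≤ x := hx
    have h1 : HasDerivAt (fun t : ℝ => 1 + 2 * t) 2 x := by
      simpa using ((hasDerivAt_id x).const_mul 2).const_add 1
    have h2 := (h1.rpow_const (p := -((k : ℝ) / 2 - 1)) (Or.inl (by positivity))).const_mul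
      (-(1 / ((k : ℝ) - 2)))
    have h3 : (k : ℝ) - 2 ≠ 0 := by linarith
    have h4 : -(1 / ((k : ℝ) - 2)) * (2 * -((k : ℝ) / 2 - 1) *
        (1 + 2 * x) ^ (-((k : ℝ) / 2 - 1) - 1)) = (1 + 2 * x) ^ (-(k / 2 : ℝ)) := by
      rw [show -((k : ℝ) / 2 - 1) - 1 = -(k / 2 : ℝ) by ring]
      field_simp
    rw [h4] at h2
    exact h2
  have hpos : ∀ x ∈ Set.Ioi (0 : ℝ), 0 ≤ (1 + 2 * x) ^ (-(k / 2 : ℝ)) := by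
    intro x hx
    have hx : 0 < x := hx
    positivity
  have hlim : Filter.Tendsto
      (fun t : ℝ => -(1 / ((k : ℝ) - 2)) * (1 + 2 * t) ^ (-((k : ℝ) / 2 - 1)))
      Filter.atTop (nhds 0) := by
    have h1 : Filter.Tendsto (fun t : ℝ => 1 + 2 * t) Filter.atTop Filter.atTop :=
      Filter.tendsto_atTop_add_const_left _ _ (Filter.tendsto_id.const_mul_atTop (by norm_num))
    simpa using ((tendsto_rpow_neg_atTop (y := (k : ℝ) / 2 - 1) (by linarith)).comp h1).const_mul
      (-(1 / ((k : ℝ) - 2)))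
  rw [← ofReal_integral_eq_lintegral_ofReal (integrableOn_Ioi_deriv_of_nonneg' hd hpos hlim)
    ((ae_restrict_iff' measurableSet_Ioi).2 (Filter.Eventually.of_forall hpos)),
    integral_Ioi_of_hasDerivAt_of_nonneg' hd hpos hlim]
  simp

lemma aux_inv {E : Type*} [NormedAddCommGroup E] [InnerProductSpace ℝ E]
    [FiniteDimensional ℝ E] [MeasurableSpace E] [BorelSpace E] (hk : 3 ≤ Module.finrank ℝ E) :
    ∫⁻ g, (ENNReal.ofReal (‖g‖ ^ 2))⁻¹ ∂(stdGaussian E) =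
      ENNReal.ofReal (1 / ((Module.finrank ℝ E : ℝ) - 2)) := by
  have h : ∀ g : E, (ENNReal.ofReal (‖g‖ ^ 2))⁻¹ =
    ∫⁻ t in Set.Ioi (0 : ℝ), ENNReal.ofReal (Real.exp (-t * ‖g‖ ^ 2)) := fun g =>
      (aux_laplace _ (by positivity)).symm
  simp_rw [h]
  rw [lintegral_lintegral_swap (Measurable.aemeasurable (by fun_prop)), ← aux_pow _ hk]
  refine setLIntegral_congr_fun measurableSet_Ioi fun t ht => ?_
  exact aux_gaussE t (le_of_lt ht)

lemma aux_proj {E : Type*} [NormedAddCommGroup E] [InnerProductSpace ℝ E]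
    [FiniteDimensional ℝ E] [MeasurableSpace E] [BorelSpace E] (V : Submodule ℝ E) :
    (stdGaussian E).map V.orthogonalProjectionOnto = stdGaussian V := by
  have : IsProbabilityMeasure ((stdGaussian E).map V.orthogonalProjectionOnto) :=
    Measure.isProbabilityMeasure_map (Measurable.aemeasurable (by fun_prop))
  apply Measure.ext_of_charFun
  ext t
  rw [charFun_stdGaussian, charFun_apply, integral_map (Measurable.aemeasurable (by fun_prop))
      (Measurable.aestronglyMeasurable (by fun_prop))]
  have h : ∀ x : E, inner ℝ (V.orthogonalProjectionOnto x) t = inner ℝ x (t : E) := by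
    intro x
    exact V.inner_orthogonalProjectionOnto_eq_of_mem_right t x
  simp_rw [h]
  rw [← charFun_apply, charFun_stdGaussian]
  simp

lemma aux_projinv (n : ℕ) (V : Submodule ℝ (EuclideanSpace ℝ (Fin n)))
    (hV : Module.finrank ℝ V + 3 ≤ n) :
    ∫⁻ y : Fin n → ℝ, (ENNReal.ofReal (‖Vᗮ.starProjection (WithLp.toLp 2 y)‖ ^ 2))⁻¹
      ∂(Measure.pi fun _ => gaussianReal 0 1) =
      ENNReal.ofReal (1 / ((n : ℝ) - Module.finrank ℝ V - 2)) := by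
  have h := V.finrank_add_finrank_orthogonal
  rw [finrank_euclideanSpace_fin] at h
  have h2 := aux_inv (E := Vᗮ) (by omega)
  rw [← aux_proj, lintegral_map (by fun_prop) (by fun_prop), ← map_pi_eq_stdGaussian,
    lintegral_map (by fun_prop) (by fun_prop)] at h2
  refine h2.trans ?_
  have h' : (Module.finrank ℝ V : ℝ) + Module.finrank ℝ Vᗮ = n := by exact_mod_cast h
  congr 2
  linarith

lemma aux_swap (n d : ℕ) (ν : Measure ℝ) [IsProbabilityMeasure ν] :
    MeasurePreserving (fun (x : Fin n → Fin d → ℝ) (j : Fin d) (i : Fin n) => x i j)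
      (Measure.pi fun _ => Measure.pi fun _ => ν) (Measure.pi fun _ => Measure.pi fun _ => ν) := by
  refine ⟨by fun_prop, ?_⟩
  symm
  refine Measure.pi_eq_generateFrom
    (C := fun _ => Set.pi Set.univ '' Set.pi Set.univ fun _ => {s : Set ℝ | MeasurableSet s})
    (fun _ => generateFrom_pi) (fun _ => isPiSystem_pi) (fun _ => ?_) ?_
  · refine ⟨fun _ => Set.univ, fun _ => ⟨fun _ => Set.univ, by simp, by simp⟩, ?_, ?_⟩
    · simp
    · exact Set.iUnion_const _
  · intro s hs
    choose S hS hS' using hs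
    have hS2 : ∀ j i, MeasurableSet (S j i) := fun j i => hS j i (Set.mem_univ _)
    rw [Measure.map_apply (by fun_prop) ?_]
    · have : (fun (x : Fin n → Fin d → ℝ) (j : Fin d) (i : Fin n) => x i j) ⁻¹' (Set.pi Set.univ s)
        = Set.pi Set.univ fun i => Set.pi Set.univ fun j => S j i := by
        ext x
        simp only [← hS', Set.mem_preimage, Set.mem_pi, Set.mem_univ, true_imp_iff]
        exact forall_comm
      rw [this]
      simp only [← hS', Measure.pi_pi]
      exact Finset.prod_comm
    · refine MeasurableSet.univ_pi fun j => ?_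
      rw [← hS']
      exact MeasurableSet.univ_pi (hS2 j)

/-- Gram matrix of a family of vectors. -/
def auxG {n m : ℕ} (c : Fin m → Fin n → ℝ) : Matrix (Fin m) (Fin m) ℝ :=
  Matrix.of c * (Matrix.of c)ᵀ

lemma auxG_unit_iff {n m : ℕ} (c : Fin m → Fin n → ℝ) :
    IsUnit (auxG c).det ↔ LinearIndependent ℝ c := by
  have hli : LinearIndependent ℝ c ↔ Function.Injective (Matrix.of c).vecMul :=
    Matrix.vecMul_injective_iff.symm
  rw [hli]
  constructor
  · intro h
    rw [← Matrix.isUnit_iff_isUnit_det] at h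
    have h2 := Matrix.vecMul_injective_of_isUnit h
    intro v w hvw
    apply h2
    have hvw : v ᵥ* Matrix.of c = w ᵥ* Matrix.of c := hvw
    change v ᵥ* auxG c = w ᵥ* auxG c
    rw [auxG, ← Matrix.vecMul_vecMul, ← Matrix.vecMul_vecMul, hvw]
  · intro h
    have h2 := Matrix.PosDef.mul_conjTranspose_self (Matrix.of c) h
    rw [Matrix.conjTranspose_eq_transpose_of_trivial] at h2
    exact h2.det_pos.ne'.isUnit

lemma auxG_apply {n m : ℕ} (c : Fin m → Fin n → ℝ) (i j : Fin m) :
    auxG c i j = inner ℝ (WithLp.toLp 2 (c i)) (WithLp.toLp 2 (c j)) := by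
  simp [auxG, Matrix.mul_apply, PiLp.inner_apply, mul_comm]

lemma auxG_det_meas {n m : ℕ} : Measurable fun c : Fin m → Fin n → ℝ => (auxG c).det := by
  apply Continuous.measurable
  apply Continuous.matrix_det
  unfold auxG
  fun_prop

lemma auxG_inv_meas {n m : ℕ} (j : Fin m) :
    Measurable fun c : Fin m → Fin n → ℝ => (auxG c)⁻¹ j j := by
  simp_rw [Matrix.inv_def, Matrix.smul_apply, Ring.inverse_eq_inv', smul_eq_mul]
  refine auxG_det_meas.inv.mul (Continuous.measurable ?_)
  have h : Continuous fun c : Fin m → Fin n → ℝ => (auxG c).adjugate := by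
    apply Continuous.matrix_adjugate
    unfold auxG
    fun_prop
  exact h.matrix_elem j j

/-- span of a family in Euclidean space -/
def auxV {n m : ℕ} (c : Fin m → Fin n → ℝ) : Submodule ℝ (EuclideanSpace ℝ (Fin n)) :=
  Submodule.span ℝ (Set.range fun i => WithLp.toLp 2 (c i))

lemma auxV_finrank_le {n m : ℕ} (c : Fin m → Fin n → ℝ) : Module.finrank ℝ (auxV c) ≤ m := by
  have := finrank_range_le_card (R := ℝ) (fun i => (WithLp.toLp 2 (c i) : EuclideanSpace ℝ (Fin n)))
  rw [Fintype.card_fin] at this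
  exact this

lemma auxLI {n m : ℕ} (c : Fin m → Fin n → ℝ) (h : LinearIndependent ℝ c) :
    LinearIndependent ℝ (fun i => (WithLp.toLp 2 (c i) : EuclideanSpace ℝ (Fin n))) :=
  h.map' (WithLp.linearEquiv 2 ℝ (Fin n → ℝ)).symm.toLinearMap (LinearEquiv.ker _)

lemma auxV_finrank {n m : ℕ} (c : Fin m → Fin n → ℝ) (h : LinearIndependent ℝ c) :
    Module.finrank ℝ (auxV c) = m := by
  have := finrank_span_eq_card (auxLI c h)
  rw [Fintype.card_fin] at this
  exact this

lemma aux_inv_entry {n m : ℕ} (j : Fin (m + 1)) (y : Fin n → ℝ) (z : Fin m → Fin n → ℝ)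
    (h : IsUnit (auxG (j.insertNth y z : Fin (m + 1) → Fin n → ℝ)).det) :
    (auxG (j.insertNth y z : Fin (m + 1) → Fin n → ℝ))⁻¹ j j *
      ‖(auxV z)ᗮ.starProjection (WithLp.toLp 2 y)‖ ^ 2 = 1 := by
  set c : Fin (m + 1) → Fin n → ℝ := j.insertNth y z with hc
  set w := (auxV z)ᗮ.starProjection (WithLp.toLp 2 y) with hw
  obtain ⟨b, hb⟩ := (Submodule.mem_span_range_iff_exists_fun ℝ).1
    ((auxV z).starProjection_apply_mem (WithLp.toLp 2 y))
  have hwy : w = WithLp.toLp 2 y - (auxV z).starProjection (WithLp.toLp 2 y) := by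
    rw [hw, Submodule.starProjection_orthogonal_val]
  let a : Fin (m + 1) → ℝ := j.insertNth 1 (-b)
  have ha : ∑ i, a i • (WithLp.toLp 2 (c i) : EuclideanSpace ℝ (Fin n)) = w := by
    rw [Fin.sum_univ_succAbove _ j, hwy, ← hb]
    simp [a, hc, sub_eq_add_neg]
  have hmem : w ∈ (auxV z)ᗮ := Submodule.starProjection_apply_mem _ _
  have hGa : auxG c *ᵥ a = Pi.single j (‖w‖ ^ 2) := by
    ext i
    have h1 : (auxG c *ᵥ a) i = inner ℝ (WithLp.toLp 2 (c i)) w := by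
      rw [← ha, inner_sum]
      simp only [Matrix.mulVec, dotProduct, auxG_apply, inner_smul_right]
      exact Finset.sum_congr rfl fun k _ => mul_comm _ _
    rw [h1]
    refine Fin.succAboveCases j ?_ (fun k => ?_) i
    · have h2 : (WithLp.toLp 2 (c j) : EuclideanSpace ℝ (Fin n)) =
          (auxV z).starProjection (WithLp.toLp 2 y) + w := by
        rw [hwy]; simp [hc]
      rw [h2, inner_add_left, real_inner_self_eq_norm_sq,
        (Submodule.mem_orthogonal _ _).1 hmem _ (Submodule.starProjection_apply_mem _ _)]
      simp
    · rw [Pi.single_eq_of_ne (Fin.succAbove_ne j k)]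
      refine (Submodule.mem_orthogonal _ _).1 hmem _ (Submodule.subset_span ⟨k, ?_⟩)
      simp [hc]
  have h3 : a = (auxG c)⁻¹ *ᵥ Pi.single j (‖w‖ ^ 2) := by
    rw [← hGa, Matrix.mulVec_mulVec, Matrix.nonsing_inv_mul _ h, Matrix.one_mulVec]
  have h4 := congrFun h3 j
  simp [a] at h4
  exact h4.symm

/-- standard Gaussian on `ℝⁿ` -/
def auxγ (n : ℕ) : Measure (Fin n → ℝ) := Measure.pi fun _ => gaussianReal 0 1

instance (n : ℕ) : IsProbabilityMeasure (auxγ n) := by unfold auxγ; infer_instance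

lemma aux_ae_pos {n m : ℕ} (hm : m + 3 ≤ n) (z : Fin m → Fin n → ℝ) :
    ∀ᵐ y ∂(auxγ n), (auxV z)ᗮ.starProjection (WithLp.toLp 2 y) ≠ 0 := by
  have h := aux_projinv n (auxV z) (by have := auxV_finrank_le z; omega)
  have h2 := ae_lt_top (μ := auxγ n) (f := fun y : Fin n → ℝ =>
    (ENNReal.ofReal (‖(auxV z)ᗮ.starProjection (WithLp.toLp 2 y)‖ ^ 2))⁻¹) (by fun_prop)
    (by rw [auxγ, h]; exact ENNReal.ofReal_ne_top)
  filter_upwards [h2] with y hy h0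
  simp [h0] at hy

lemma aux_ae_unit {n : ℕ} (m : ℕ) (hm : m + 2 ≤ n) :
    ∀ᵐ c ∂(Measure.pi fun _ : Fin m => auxγ n), IsUnit (auxG c).det := by
  induction m with
  | zero => exact Filter.Eventually.of_forall fun c => by simp
  | succ m ih =>
    have hmp := (measurePreserving_piFinSuccAbove (fun _ : Fin (m + 1) => auxγ n) 0).symm
    rw [← hmp.map_eq, ae_map_iff (by fun_prop)]
    swap
    · simp only [isUnit_iff_ne_zero]
      exact auxG_det_meas (measurableSet_singleton 0).compl
    have hms : MeasurableSet {p : (Fin n → ℝ) × (Fin m → Fin n → ℝ) | IsUnit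
        (auxG ((MeasurableEquiv.piFinSuccAbove (fun _ : Fin (m + 1) => Fin n → ℝ) 0).symm p)).det} := by
      simp only [isUnit_iff_ne_zero]
      exact (auxG_det_meas.comp (MeasurableEquiv.measurable _)) (measurableSet_singleton 0).compl
    refine (Measure.ae_prod_iff_ae_ae hms).2 ?_
    refine (Measure.ae_ae_comm hms).2 ?_
    filter_upwards [ih (by omega)] with z hz
    filter_upwards [aux_ae_pos (by omega) z] with y hy
    rw [auxG_unit_iff] at hz ⊢
    change LinearIndependent ℝ (Fin.insertNth 0 y z : Fin (m + 1) → Fin n → ℝ)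
    rw [Fin.insertNth_zero']
    refine linearIndependent_finCons.2 ⟨hz, fun hmem => hy ?_⟩
    rw [Submodule.starProjection_apply_eq_zero_iff, Submodule.orthogonal_orthogonal]
    have h5 := Submodule.mem_map_of_mem (f := (WithLp.linearEquiv 2 ℝ (Fin n → ℝ)).symm.toLinearMap) hmem
    rw [Submodule.map_span, ← Set.range_comp] at h5
    exact h5

lemma aux_lint {n m : ℕ} (hm : m + 3 ≤ n) (j : Fin (m + 1)) :
    ∫⁻ c, ENNReal.ofReal ((auxG c)⁻¹ j j) ∂(Measure.pi fun _ : Fin (m + 1) => auxγ n) =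
      ENNReal.ofReal (1 / ((n : ℝ) - m - 2)) := by
  have hmp := (measurePreserving_piFinSuccAbove (fun _ : Fin (m + 1) => auxγ n) j).symm
  have hu := aux_ae_unit (n := n) (m + 1) (by omega)
  have hms : MeasurableSet {p : (Fin n → ℝ) × (Fin m → Fin n → ℝ) | IsUnit
      (auxG ((MeasurableEquiv.piFinSuccAbove (fun _ : Fin (m + 1) => Fin n → ℝ) j).symm p)).det} := by
    simp only [isUnit_iff_ne_zero]
    exact (auxG_det_meas.comp (MeasurableEquiv.measurable _)) (measurableSet_singleton 0).compl
  have hu2 := (Measure.ae_ae_comm hms).1 (Measure.ae_ae_of_ae_prod (hmp.quasiMeasurePreserving.ae hu))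
  rw [← hmp.lintegral_comp (auxG_inv_meas j).ennreal_ofReal]
  refine (lintegral_prod_symm' _
    ((auxG_inv_meas j).ennreal_ofReal.comp (MeasurableEquiv.measurable _))).trans ?_
  have hz : ∀ᵐ z ∂(Measure.pi fun _ : Fin m => auxγ n), ∫⁻ y, ENNReal.ofReal
      ((auxG ((MeasurableEquiv.piFinSuccAbove (fun _ : Fin (m + 1) => Fin n → ℝ) j).symm
        (y, z)))⁻¹ j j) ∂(auxγ n) = ENNReal.ofReal (1 / ((n : ℝ) - m - 2)) := by
    filter_upwards [hu2, aux_ae_unit (n := n) m (by omega)] with z hz1 hz2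
    rw [auxG_unit_iff] at hz2
    have hf := auxV_finrank z hz2
    have h := aux_projinv n (auxV z) (by omega)
    rw [hf] at h
    rw [← h]
    refine lintegral_congr_ae ?_
    filter_upwards [hz1] with y hy
    have h1 := aux_inv_entry j y z hy
    have hne : ‖(auxV z)ᗮ.starProjection (WithLp.toLp 2 y)‖ ^ 2 ≠ 0 := right_ne_zero_of_mul_eq_one h1
    have hpos : 0 < ‖(auxV z)ᗮ.starProjection (WithLp.toLp 2 y)‖ ^ 2 := by positivity
    rw [← ENNReal.ofReal_inv_of_pos hpos]
    congr 1
    exact eq_inv_of_mul_eq_one_left h1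
  exact (lintegral_congr_ae hz).trans (by simp)

lemma aux_int {n m : ℕ} (hm : m + 3 ≤ n) (j : Fin (m + 1)) :
    Integrable (fun c => (auxG c)⁻¹ j j) (Measure.pi fun _ : Fin (m + 1) => auxγ n) ∧
    ∫ c, (auxG c)⁻¹ j j ∂(Measure.pi fun _ : Fin (m + 1) => auxγ n) = 1 / ((n : ℝ) - m - 2) := by
  have hnn : ∀ c : Fin (m + 1) → Fin n → ℝ, 0 ≤ (auxG c)⁻¹ j j := by
    intro c
    have h2 := (Matrix.posSemidef_self_mul_conjTranspose (Matrix.of c)).inv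
    rw [Matrix.conjTranspose_eq_transpose_of_trivial] at h2
    exact h2.diag_nonneg
  have hl := aux_lint hm j
  have hpos : (0 : ℝ) ≤ 1 / ((n : ℝ) - m - 2) := by
    have : (m : ℝ) + 3 ≤ n := by exact_mod_cast hm
    apply div_nonneg <;> linarith
  constructor
  · refine ⟨(auxG_inv_meas j).aestronglyMeasurable, ?_⟩
    rw [hasFiniteIntegral_iff_ofReal (Filter.Eventually.of_forall hnn), hl]
    exact ENNReal.ofReal_lt_top
  · rw [integral_eq_lintegral_of_nonneg_ae (Filter.Eventually.of_forall hnn)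
      (auxG_inv_meas j).aestronglyMeasurable, hl, ENNReal.toReal_ofReal hpos]

theorem stmt13 (n d : ℕ) (hnd : d + 2 ≤ n) :
    -- μ is the law of an n × d matrix with iid N(0,1) entries
    let μ : Measure (Fin n → Fin d → ℝ) :=
      Measure.pi fun _ : Fin n => Measure.pi fun _ : Fin d => gaussianReal 0 1
    -- almost surely XᵀX is invertible
    (∀ᵐ x ∂μ, IsUnit ((Matrix.of x)ᵀ * Matrix.of x).det) ∧
    -- E[trace((XᵀX)⁻¹)] = d/(n - d - 1)
    ∫ x, (((Matrix.of x)ᵀ * Matrix.of x)⁻¹).trace ∂μ =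
      (d : ℝ) / ((n : ℝ) - d - 1) := by
  intro μ
  have hmp : MeasurePreserving (fun (x : Fin n → Fin d → ℝ) (j : Fin d) (i : Fin n) => x i j)
      μ (Measure.pi fun _ => auxγ n) := aux_swap n d (gaussianReal 0 1)
  have hG : ∀ x : Fin n → Fin d → ℝ, (Matrix.of x)ᵀ * Matrix.of x = auxG fun j i => x i j :=
    fun x => rfl
  simp_rw [hG]
  refine ⟨hmp.quasiMeasurePreserving.ae (aux_ae_unit d hnd), ?_⟩
  cases d with
  | zero => simp [Matrix.trace]
  | succ m =>
    have hm : m + 3 ≤ n := by omega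
    simp only [Matrix.trace, Matrix.diag_apply]
    have hsum : ∫ c, ∑ j, (auxG c)⁻¹ j j ∂(Measure.pi fun _ : Fin (m + 1) => auxγ n) =
        ((m + 1 : ℕ) : ℝ) / ((n : ℝ) - (m + 1 : ℕ) - 1) := by
      rw [integral_finsetSum _ fun j _ => (aux_int hm j).1]
      simp_rw [(aux_int hm _).2]
      simp
      rw [div_eq_mul_inv]
      congr 2
      ring
    rw [← hsum, ← hmp.map_eq, integral_map hmp.measurable.aemeasurable]
    refine Measurable.aestronglyMeasurable ?_
    exact Finset.measurable_sum _ fun j _ => auxG_inv_meas j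
end
end

section
/- Fix β₀ ∈ ℝ^{d₀} and σ > 0, let n ≤ d₀ - 2, let X be n × d₀ with iid N(0,1) entries, e ~ N(0, σ²I_n) independent of X, y = Xβ₀ + e, and let β̂ = Xᵀ(XXᵀ)⁻¹y be the minimum norm OLS estimator (defined a.s.). Let (y', x') be an independent test point from the same model. Then E[(y' - x'ᵀβ̂)²] = ‖β₀‖²(1 - n/d₀) + σ²(1 + n/(d₀ - 1 - n)). -/
open MeasureTheory ProbabilityTheory Matrix

noncomputable section

lemma gauss_exp (c : ℝ) (hc : 0 ≤ c) :
    ∫ x, Real.exp (-c * x ^ 2) ∂(gaussianReal 0 1) = (1 + 2 * c) ^ (-(1/2) : ℝ) := by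
  rw [integral_gaussianReal_eq_integral_smul (by norm_num)]
  have h : ∀ x : ℝ, gaussianPDFReal 0 1 x • Real.exp (-c * x ^ 2) =
      (√(2 * Real.pi))⁻¹ * Real.exp (-(c + 1/2) * x ^ 2) := by
    intro x
    simp only [gaussianPDFReal, smul_eq_mul, NNReal.coe_one, mul_one, sub_zero]
    rw [mul_assoc, ← Real.exp_add]
    congr 2
    ring
  simp_rw [h]
  rw [integral_const_mul, integral_gaussian, Real.rpow_neg (by positivity), ← Real.sqrt_eq_rpow,
    ← Real.sqrt_inv, ← Real.sqrt_mul (by positivity), ← Real.sqrt_inv]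
  congr 1
  have := Real.pi_pos
  field_simp
  ring

lemma lintegral_exp_inv (q : ℝ) (hq : 0 ≤ q) :
    ∫⁻ t in Set.Ioi (0:ℝ), ENNReal.ofReal (Real.exp (-t * q)) = (ENNReal.ofReal q)⁻¹ := by
  rcases hq.eq_or_lt with rfl | hq
  · simp
  · rw [← ofReal_integral_eq_lintegral_ofReal, ← ENNReal.ofReal_inv_of_pos hq]
    · congr 1
      have := integral_exp_mul_Ioi (a := -q) (by linarith) 0
      have h2 : ∀ x : ℝ, -x * q = -q * x := fun x => by ring
      simp_rw [h2]
      rw [this]; simp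
    · have := integrableOn_exp_mul_Ioi (a := -q) (by linarith) 0
      refine this.congr_fun (fun x _ => by simp [mul_comm]) measurableSet_Ioi
    · exact Filter.Eventually.of_forall fun x => (Real.exp_pos _).le

lemma lintegral_rpow_k (k : ℝ) (hk : 2 < k) :
    ∫⁻ t in Set.Ioi (0:ℝ), ENNReal.ofReal ((1 + 2 * t) ^ (-k/2)) = ENNReal.ofReal (1 / (k - 2)) := by
  have hd : ∀ x ∈ Set.Ici (0:ℝ), HasDerivAt (fun t : ℝ => -(1 / (k-2)) * (1 + 2 * t) ^ (1 - k/2))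
      ((1 + 2 * x) ^ (-k/2)) x := by
    intro x hx
    have hx : 0 ≤ x := hx
    have h1 : HasDerivAt (fun t : ℝ => 1 + 2 * t) 2 x := by
      simpa using ((hasDerivAt_id x).const_mul 2).const_add 1
    have h2 := (h1.rpow_const (p := 1 - k/2) (Or.inl (by positivity))).const_mul (-(1 / (k-2)))
    refine h2.congr_deriv ?_
    have : k - 2 ≠ 0 := by linarith
    rw [show 1 - k/2 - 1 = -k/2 by ring]
    field_simp
    ring
  have ht : Filter.Tendsto (fun t : ℝ => -(1 / (k-2)) * (1 + 2 * t) ^ (1 - k/2)) Filter.atTop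
      (nhds 0) := by
    have h3 : Filter.Tendsto (fun t : ℝ => (1 + 2 * t)) Filter.atTop Filter.atTop :=
      Filter.tendsto_atTop_add_const_left _ _ (Filter.tendsto_id.const_mul_atTop (by norm_num))
    have h4 := (tendsto_rpow_neg_atTop (y := k/2 - 1) (by linarith)).comp h3
    have h5 := h4.const_mul (-(1 / (k-2)))
    simp only [mul_zero, Function.comp_def, neg_sub] at h5
    exact h5
  have hpos : ∀ x ∈ Set.Ioi (0:ℝ), 0 ≤ (1 + 2 * x) ^ (-k/2) := by
    intro x hx
    have hx : 0 < x := hx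
    positivity
  rw [← ofReal_integral_eq_lintegral_ofReal]
  · rw [integral_Ioi_of_hasDerivAt_of_nonneg' hd hpos ht]
    congr 1
    simp
  · exact integrableOn_Ioi_deriv_of_nonneg' hd hpos ht
  · exact (ae_restrict_iff' measurableSet_Ioi).2 (Filter.Eventually.of_forall hpos)

lemma rotate {d : ℕ} (b : OrthonormalBasis (Fin d) ℝ (EuclideanSpace ℝ (Fin d)))
    (f : EuclideanSpace ℝ (Fin d) → ℝ) (hf : Measurable f) :
    ∫ x, f (WithLp.toLp 2 x) ∂(Measure.pi fun _ : Fin d => gaussianReal 0 1) =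
    ∫ z : Fin d → ℝ, f (∑ i, z i • b i) ∂(Measure.pi fun _ : Fin d => gaussianReal 0 1) := by
  have h := (map_pi_eq_stdGaussian (ι := Fin d)).trans (stdGaussian_eq_map_pi_orthonormalBasis b)
  rw [← integral_map (φ := WithLp.toLp 2) (by fun_prop) hf.aestronglyMeasurable, h,
    integral_map (Measurable.aemeasurable (by fun_prop)) hf.aestronglyMeasurable]

lemma laplace {d : ℕ} (A : Matrix (Fin d) (Fin d) ℝ) (hA : A.IsHermitian) (hAA : A * A = A)
    (t : ℝ) (ht : 0 ≤ t) :
    ∫ x : Fin d → ℝ, Real.exp (-t * (x ⬝ᵥ A *ᵥ x)) ∂(Measure.pi fun _ : Fin d => gaussianReal 0 1)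
     = (1 + 2 * t) ^ (-A.trace/2) := by
  have h := rotate hA.eigenvectorBasis (fun y => Real.exp (-t * (y.ofLp ⬝ᵥ A *ᵥ y.ofLp)))
    (by
      apply Continuous.measurable
      fun_prop)
  simp only at h
  rw [h]
  have hev : ∀ i, hA.eigenvalues i = 0 ∨ hA.eigenvalues i = 1 := by
    intro i
    have h1 := hA.mulVec_eigenvectorBasis i
    have h2 : A *ᵥ (A *ᵥ (hA.eigenvectorBasis i).ofLp) = A *ᵥ (hA.eigenvectorBasis i).ofLp := by
      rw [mulVec_mulVec, hAA]
    rw [h1, mulVec_smul, h1, smul_smul] at h2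
    have h3 : (hA.eigenvectorBasis i).ofLp ≠ 0 := by
      intro h0
      exact hA.eigenvectorBasis.orthonormal.ne_zero i (by ext j; simp [h0])
    have h4 := smul_left_injective ℝ h3 h2
    have h5 : hA.eigenvalues i * (hA.eigenvalues i - 1) = 0 := by linarith
    rcases mul_eq_zero.1 h5 with h | h
    · left; exact h
    · right; linarith
  have hq : ∀ z : Fin d → ℝ, (∑ i, z i • hA.eigenvectorBasis i).ofLp ⬝ᵥ
      A *ᵥ (∑ i, z i • hA.eigenvectorBasis i).ofLp = ∑ i, hA.eigenvalues i * z i ^ 2 := by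
    intro z
    have h1 : A *ᵥ (∑ i, z i • hA.eigenvectorBasis i).ofLp =
        (∑ i, (hA.eigenvalues i * z i) • hA.eigenvectorBasis i).ofLp := by
      simp only [WithLp.ofLp_sum, WithLp.ofLp_smul, mulVec_sum, mulVec_smul,
        hA.mulVec_eigenvectorBasis, smul_smul, mul_comm]
    rw [h1]
    have h2 := EuclideanSpace.inner_eq_star_dotProduct (𝕜 := ℝ)
      (∑ i, (hA.eigenvalues i * z i) • hA.eigenvectorBasis i) (∑ i, z i • hA.eigenvectorBasis i)
    simp only [star_trivial] at h2
    rw [← h2, hA.eigenvectorBasis.orthonormal.inner_sum]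
    simp
    refine Finset.sum_congr rfl fun i _ => by ring
  simp_rw [hq, Finset.mul_sum, Real.exp_sum]
  rw [integral_fintype_prod_eq_prod (fun i x => Real.exp (-t * (hA.eigenvalues i * x ^ 2)))]
  have hfac : ∀ i, ∫ x, Real.exp (-t * (hA.eigenvalues i * x ^ 2)) ∂(gaussianReal 0 1) =
      (1 + 2 * t) ^ (-hA.eigenvalues i / 2) := by
    intro i
    have h0 : 0 ≤ t * hA.eigenvalues i := by
      rcases hev i with h | h <;> rw [h] <;> linarith
    have := gauss_exp _ h0
    simp only [← neg_mul, mul_assoc] at this ⊢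
    rw [this]
    rcases hev i with h | h <;> rw [h] <;> norm_num
  simp_rw [hfac]
  rw [← Real.rpow_sum_of_pos (by positivity), hA.trace_eq_sum_eigenvalues]
  simp [← Finset.sum_div]

lemma chi_inv {d : ℕ} (A : Matrix (Fin d) (Fin d) ℝ) (hA : A.IsHermitian) (hAA : A * A = A)
    (hk : 2 < A.trace) :
    ∫⁻ x : Fin d → ℝ, (ENNReal.ofReal (x ⬝ᵥ A *ᵥ x))⁻¹
      ∂(Measure.pi fun _ : Fin d => gaussianReal 0 1) = ENNReal.ofReal (1 / (A.trace - 2)) := by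
  have hq : ∀ x : Fin d → ℝ, 0 ≤ x ⬝ᵥ A *ᵥ x := by
    intro x
    have : x ⬝ᵥ A *ᵥ x = (A *ᵥ x) ⬝ᵥ (A *ᵥ x) := by
      nth_rw 1 [← hAA]
      rw [← mulVec_mulVec, dotProduct_mulVec, ← mulVec_transpose, show Aᵀ = A from by simpa using hA.eq]
    rw [this]
    exact Finset.sum_nonneg fun i _ => mul_self_nonneg _
  simp_rw [fun x => (lintegral_exp_inv _ (hq x)).symm]
  rw [lintegral_lintegral_swap, ← lintegral_rpow_k _ hk]
  · refine setLIntegral_congr_fun measurableSet_Ioi fun t ht => ?_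
    have ht : 0 < t := ht
    rw [← laplace A hA hAA t ht.le, ofReal_integral_eq_lintegral_ofReal]
    · refine Integrable.of_bound (C := 1) ?_ ?_
      · exact (Continuous.aestronglyMeasurable (by fun_prop))
      · refine Filter.Eventually.of_forall fun x => ?_
        rw [Real.norm_eq_abs, abs_of_pos (Real.exp_pos _), Real.exp_le_one_iff]
        nlinarith [hq x]
    · exact Filter.Eventually.of_forall fun x => (Real.exp_pos _).le
  · apply Measurable.aemeasurable
    apply ENNReal.measurable_ofReal.comp
    apply Continuous.measurable
    fun_prop

def rgram {n d : ℕ} (X : Fin n → Fin d → ℝ) : Matrix (Fin n) (Fin n) ℝ :=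
  Matrix.of X * (Matrix.of X)ᵀ

def proj {n d : ℕ} (X : Fin n → Fin d → ℝ) : Matrix (Fin d) (Fin d) ℝ :=
  (Matrix.of X)ᵀ * (rgram X)⁻¹ * Matrix.of X

lemma gram_symm {n d : ℕ} (X : Fin n → Fin d → ℝ) : (rgram X)ᵀ = rgram X := by
  simp [rgram]

lemma gram_inv_symm {n d : ℕ} (X : Fin n → Fin d → ℝ) : ((rgram X)⁻¹)ᵀ = (rgram X)⁻¹ := by
  rw [transpose_nonsing_inv, gram_symm]

lemma proj_symm {n d : ℕ} (X : Fin n → Fin d → ℝ) : (proj X)ᵀ = proj X := by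
  simp [proj, gram_inv_symm, Matrix.mul_assoc]

lemma mul_proj {n d : ℕ} (X : Fin n → Fin d → ℝ) (h : (rgram X).det ≠ 0) :
    Matrix.of X * proj X = Matrix.of X := by
  rw [proj, ← Matrix.mul_assoc, ← Matrix.mul_assoc,
    show Matrix.of X * (Matrix.of X)ᵀ = rgram X from rfl, Matrix.mul_nonsing_inv _ (isUnit_iff_ne_zero.2 h), Matrix.one_mul]

lemma proj_idem {n d : ℕ} (X : Fin n → Fin d → ℝ) (h : (rgram X).det ≠ 0) :
    proj X * proj X = proj X := by
  nth_rw 1 [proj]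
  rw [Matrix.mul_assoc, mul_proj X h, proj]

lemma proj_trace {n d : ℕ} (X : Fin n → Fin d → ℝ) (h : (rgram X).det ≠ 0) :
    (proj X).trace = n := by
  rw [proj, Matrix.mul_assoc, Matrix.trace_mul_comm, Matrix.mul_assoc]
  change ((rgram X)⁻¹ * rgram X).trace = _
  rw [Matrix.nonsing_inv_mul _ (isUnit_iff_ne_zero.2 h)]
  simp

lemma comp_idem {n d : ℕ} (X : Fin n → Fin d → ℝ) (h : (rgram X).det ≠ 0) :
    (1 - proj X) * (1 - proj X) = 1 - proj X := by
  rw [sub_mul, mul_sub, mul_sub, proj_idem X h]; simp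

lemma comp_herm {n d : ℕ} (X : Fin n → Fin d → ℝ) : (1 - proj X).IsHermitian := by
  rw [Matrix.IsHermitian, Matrix.conjTranspose_eq_transpose_of_trivial]
  simp [proj_symm]

lemma comp_trace {n d : ℕ} (X : Fin n → Fin d → ℝ) (h : (rgram X).det ≠ 0) :
    (1 - proj X).trace = d - n := by
  rw [Matrix.trace_sub, proj_trace X h]; simp

def qf {m d : ℕ} (i : Fin (m+1)) (X : Fin (m+1) → Fin d → ℝ) : ℝ :=
  X i ⬝ᵥ (1 - proj (fun j => X (i.succAbove j))) *ᵥ X i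

lemma schur {m d : ℕ} (i : Fin (m+1)) (X : Fin (m+1) → Fin d → ℝ)
    (h : (rgram (fun j => X (i.succAbove j))).det ≠ 0) (hq : qf i X ≠ 0) :
    (rgram X).det ≠ 0 ∧ (rgram X)⁻¹ i i = (qf i X)⁻¹ := by
  set X' : Fin m → Fin d → ℝ := fun j => X (i.succAbove j) with hX'
  set w : Fin d → ℝ := (1 - proj X') *ᵥ X i with hw
  set c : Fin m → ℝ := (rgram X')⁻¹ *ᵥ (Matrix.of X' *ᵥ X i) with hc
  let u : Fin (m+1) → ℝ := i.insertNth (α := fun _ => ℝ) 1 (fun j => - c j)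
  have hui : u i = 1 := by simp [u]
  have huj : ∀ j, u (i.succAbove j) = - c j := by simp [u]
  have h1 : (Matrix.of X)ᵀ *ᵥ u = w := by
    have h2 : w = X i - (Matrix.of X')ᵀ *ᵥ c := by
      rw [hw, hc, sub_mulVec, one_mulVec, proj, ← mulVec_mulVec, ← mulVec_mulVec]
    rw [h2]
    ext a
    simp only [mulVec, dotProduct, transpose_apply, of_apply, Pi.sub_apply]
    rw [Fin.sum_univ_succAbove _ i, hui]
    simp [huj, hX', sub_eq_add_neg]
  have h2 : rgram X *ᵥ u = qf i X • Pi.single i 1 := by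
    rw [rgram, ← mulVec_mulVec, h1]
    ext a
    rcases Fin.eq_self_or_eq_succAbove i a with rfl | ⟨j, rfl⟩
    · simp [mulVec, qf, hw, hX']
    · have h3 : Matrix.of X' *ᵥ w = 0 := by
        rw [hw, mulVec_mulVec, Matrix.mul_sub, mul_proj X' h]
        simp
      have h4 := congrFun h3 j
      simp only [mulVec, of_apply, Pi.zero_apply] at h4
      simp [mulVec, of_apply, hX'] at h4 ⊢
      exact h4
  have hdet : (rgram X).det ≠ 0 := by
    intro h0
    obtain ⟨v, hv, hv0⟩ := Matrix.exists_mulVec_eq_zero_iff.2 h0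
    have h5 : v i = 0 := by
      have h6 : v ⬝ᵥ (rgram X *ᵥ u) = 0 := by
        rw [dotProduct_mulVec, ← mulVec_transpose, gram_symm, hv0, zero_dotProduct]
      rw [h2] at h6
      simpa [hq] using h6
    have h7 : rgram X' *ᵥ (fun j => v (i.succAbove j)) = 0 := by
      ext j
      have h8 := congrFun hv0 (i.succAbove j)
      simp only [mulVec, dotProduct] at h8
      rw [Fin.sum_univ_succAbove _ i, h5] at h8
      simpa [mulVec, dotProduct, rgram, Matrix.mul_apply, hX'] using h8
    have h9 : (fun j => v (i.succAbove j)) = 0 := by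
      by_contra hne
      exact h (Matrix.exists_mulVec_eq_zero_iff.1 ⟨_, hne, h7⟩)
    apply hv
    ext a
    rcases Fin.eq_self_or_eq_succAbove i a with rfl | ⟨j, rfl⟩
    · exact h5
    · exact congrFun h9 j
  refine ⟨hdet, ?_⟩
  have h10 : u = qf i X • ((rgram X)⁻¹ *ᵥ Pi.single i 1) := by
    rw [← mulVec_smul, ← h2, mulVec_mulVec, Matrix.nonsing_inv_mul _ (isUnit_iff_ne_zero.2 hdet),
      one_mulVec]
  have h11 := congrFun h10 i
  rw [hui] at h11
  simp at h11
  exact eq_inv_of_mul_eq_one_right h11.symm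

lemma meas_gram_inv_apply {n d : ℕ} (i j : Fin n) :
    Measurable fun X : Fin n → Fin d → ℝ => (rgram X)⁻¹ i j := by
  have hc : Continuous fun X : Fin n → Fin d → ℝ => rgram X := by
    unfold rgram
    have : Continuous fun X : Fin n → Fin d → ℝ => Matrix.of X := continuous_id
    fun_prop
  simp only [Matrix.inv_def, Ring.inverse_eq_inv', Matrix.smul_apply, smul_eq_mul]
  refine Measurable.mul (hc.matrix_det.measurable.inv) ?_
  have := hc.matrix_adjugate
  exact (this.matrix_elem i j).measurable

lemma meas_M {n d : ℕ} (a : Fin d) (i : Fin n) :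
    Measurable fun X : Fin n → Fin d → ℝ => ((Matrix.of X)ᵀ * (rgram X)⁻¹) a i := by
  have h : ∀ X : Fin n → Fin d → ℝ, ((Matrix.of X)ᵀ * (rgram X)⁻¹) a i =
      ∑ j, X j a * (rgram X)⁻¹ j i := fun X => by
    rw [Matrix.mul_apply]; rfl
  simp only [h]
  refine Finset.measurable_sum _ fun j _ => Measurable.mul ?_ ?_
  · exact (measurable_pi_apply a).comp (measurable_pi_apply j)
  · exact meas_gram_inv_apply (d := d) j i

lemma meas_proj {n d : ℕ} (a b : Fin d) :
    Measurable fun X : Fin n → Fin d → ℝ => proj X a b := by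
  have h : ∀ X : Fin n → Fin d → ℝ, proj X a b =
      ∑ j, ((Matrix.of X)ᵀ * (rgram X)⁻¹) a j * X j b := fun X => by
    rw [proj, Matrix.mul_apply]; rfl
  simp only [h]
  refine Finset.measurable_sum _ fun j _ => Measurable.mul ?_ ?_
  · exact meas_M (d := d) a j
  · exact (measurable_pi_apply b).comp (measurable_pi_apply j)

lemma meas_qf {m d : ℕ} (i : Fin (m+1)) :
    Measurable fun X : Fin (m+1) → Fin d → ℝ => qf i X := by
  unfold qf
  simp only [dotProduct, mulVec, Matrix.sub_apply]
  refine Finset.measurable_sum _ fun a _ => Measurable.mul (by fun_prop) ?_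
  refine Finset.measurable_sum _ fun b _ => Measurable.mul ?_ (by fun_prop)
  refine Measurable.sub measurable_const ?_
  exact (meas_proj a b).comp (by fun_prop : Measurable fun X : Fin (m+1) → Fin d → ℝ => fun j => X (i.succAbove j))

abbrev gv (d : ℕ) : Measure (Fin d → ℝ) := Measure.pi fun _ : Fin d => gaussianReal 0 1
abbrev gm (n d : ℕ) : Measure (Fin n → Fin d → ℝ) := Measure.pi fun _ : Fin n => gv d

lemma lintegral_qf {m d : ℕ} (hmd : m + 1 + 2 ≤ d) (i : Fin (m+1))
    (h : ∀ᵐ X ∂(gm m d), (rgram X).det ≠ 0) :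
    ∫⁻ X, (ENNReal.ofReal (qf i X))⁻¹ ∂(gm (m+1) d) = ENNReal.ofReal (1 / ((d:ℝ) - m - 2)) := by
  have hmp := (measurePreserving_piFinSuccAbove (fun _ : Fin (m+1) => gv d) i).symm
  rw [← hmp.lintegral_comp_emb (MeasurableEquiv.measurableEmbedding _), lintegral_prod_symm]
  · have : ∀ᵐ X ∂(gm m d), ∫⁻ x, (ENNReal.ofReal (qf i
        ((MeasurableEquiv.piFinSuccAbove (fun _ => Fin d → ℝ) i).symm (x, X))))⁻¹ ∂(gv d) =
        ENNReal.ofReal (1 / ((d:ℝ) - m - 2)) := by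
      filter_upwards [h] with X hX
      have h2 : (2:ℝ) < (1 - proj X).trace := by
        rw [comp_trace X hX]
        have : ((m + 1 + 2 : ℕ):ℝ) ≤ d := by exact_mod_cast hmd
        push_cast at this
        linarith
      have := chi_inv _ (comp_herm X) (comp_idem X hX) h2
      rw [comp_trace X hX] at this
      rw [← this]
      refine lintegral_congr fun x => ?_
      have hxi : (MeasurableEquiv.piFinSuccAbove (fun _ => Fin d → ℝ) i).symm (x, X) =
        i.insertNth (α := fun _ => Fin d → ℝ) x X := rfl
      simp [qf, hxi]
    rw [lintegral_congr_ae this]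
    simp
  · exact ((meas_qf i).comp (MeasurableEquiv.measurable _)).ennreal_ofReal.inv.aemeasurable

lemma ae_qf {m d : ℕ} (hmd : m + 1 + 2 ≤ d) (i : Fin (m+1))
    (h : ∀ᵐ X ∂(gm m d), (rgram X).det ≠ 0) :
    ∀ᵐ X ∂(gm (m+1) d), 0 < qf i X ∧ (rgram X).det ≠ 0 ∧ (rgram X)⁻¹ i i = (qf i X)⁻¹ := by
  have h1 : ∀ᵐ X ∂(gm (m+1) d), (ENNReal.ofReal (qf i X))⁻¹ < ⊤ := by
    refine ae_lt_top (meas_qf i).ennreal_ofReal.inv ?_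
    rw [lintegral_qf hmd i h]
    exact ENNReal.ofReal_ne_top
  have hmp := (measurePreserving_piFinSuccAbove (fun _ : Fin (m+1) => gv d) i)
  have hmp2 := (measurePreserving_snd (μ := gv d) (ν := gm m d)).comp hmp
  have h2 := hmp2.quasiMeasurePreserving.ae h
  filter_upwards [h1, h2] with X hX1 hX2
  have hq : 0 < qf i X := by simpa using hX1
  exact ⟨hq, schur i X hX2 hq.ne'⟩

lemma ae_det (n d : ℕ) (hnd : n + 2 ≤ d) : ∀ᵐ X ∂(gm n d), (rgram X).det ≠ 0 := by
  induction n with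
  | zero => exact Filter.Eventually.of_forall fun X => by simp
  | succ m ih =>
    filter_upwards [ae_qf hnd 0 (ih (by omega))] with X hX using hX.2.1

lemma integral_gram_inv (n d : ℕ) (hnd : n + 2 ≤ d) (i : Fin n) :
    Integrable (fun X => (rgram X)⁻¹ i i) (gm n d) ∧
    ∫ X, (rgram X)⁻¹ i i ∂(gm n d) = 1 / ((d:ℝ) - 1 - n) := by
  obtain _ | m := n
  · exact i.elim0
  have h0 := ae_qf hnd i (ae_det m d (by omega))
  have hnn : 0 ≤ᵐ[gm (m+1) d] fun X => (rgram X)⁻¹ i i := by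
    filter_upwards [h0] with X hX
    rw [hX.2.2]
    exact inv_nonneg.2 hX.1.le
  have hl : ∫⁻ X, ENNReal.ofReal ((rgram X)⁻¹ i i) ∂(gm (m+1) d) =
      ENNReal.ofReal (1 / ((d:ℝ) - 1 - (m+1 : ℕ))) := by
    rw [show (d:ℝ) - 1 - (m+1 : ℕ) = d - m - 2 by push_cast; ring,
      ← lintegral_qf hnd i (ae_det m d (by omega))]
    refine lintegral_congr_ae ?_
    filter_upwards [h0] with X hX
    rw [hX.2.2, ENNReal.ofReal_inv_of_pos hX.1]
  have hm := (meas_gram_inv_apply (d := d) i i).aestronglyMeasurable (μ := gm (m+1) d)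
  constructor
  · refine ⟨hm, ?_⟩
    rw [hasFiniteIntegral_iff_ofReal hnn, hl]
    exact ENNReal.ofReal_lt_top
  · rw [integral_eq_lintegral_of_nonneg_ae hnn hm, hl, ENNReal.toReal_ofReal]
    have : ((m + 1 + 2 : ℕ):ℝ) ≤ d := by exact_mod_cast hnd
    push_cast at this ⊢
    apply div_nonneg <;> linarith

lemma proj_bound {n d : ℕ} (X : Fin n → Fin d → ℝ) (h : (rgram X).det ≠ 0) (a b : Fin d) :
    |proj X a b| ≤ 1 := by
  have hs : ∀ a b, proj X a b = proj X b a := fun a b => congrFun (congrFun (proj_symm X) b) a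
  have h1 : ∀ a, proj X a a = ∑ b, proj X a b ^ 2 := by
    intro a
    nth_rw 1 [← proj_idem X h]
    rw [Matrix.mul_apply]
    exact Finset.sum_congr rfl fun b _ => by rw [hs b a]; ring
  have h2 : ∀ a b, proj X a b ^ 2 ≤ proj X a a := by
    intro a b
    rw [h1 a]
    exact Finset.single_le_sum (f := fun b => proj X a b ^ 2) (fun _ _ => sq_nonneg _)
      (Finset.mem_univ b)
  have h3 : proj X a a ≤ 1 := by nlinarith [h2 a a]
  rw [abs_le]
  constructor <;> nlinarith [h2 a b]

lemma integrable_proj (n d : ℕ) (hnd : n + 2 ≤ d) (a b : Fin d) :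
    Integrable (fun X => proj X a b) (gm n d) := by
  refine Integrable.of_bound (C := 1) (meas_proj a b).aestronglyMeasurable ?_
  filter_upwards [ae_det n d hnd] with X hX using proj_bound X hX a b

lemma mp_invariance (n d : ℕ) (g : (Fin d → ℝ) → (Fin d → ℝ)) (hg : MeasurePreserving g (gv d) (gv d))
    (a b : Fin d) :
    ∫ X, proj (fun i => g (X i)) a b ∂(gm n d) = ∫ X, proj X a b ∂(gm n d) := by
  have h := measurePreserving_pi (fun _ : Fin n => gv d) (fun _ : Fin n => gv d) (fun _ => hg)
  have h2 := integral_map h.aemeasurable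
    (meas_proj (n := n) a b).aestronglyMeasurable
  rw [h.map_eq] at h2
  exact h2.symm

lemma proj_neg {n d : ℕ} (X : Fin n → Fin d → ℝ) (s : Fin d → ℝ) (hs : ∀ a, s a * s a = 1)
    (a b : Fin d) : proj (fun i c => s c * X i c) a b = s a * s b * proj X a b := by
  have h1 : rgram (fun i c => s c * X i c) = rgram X := by
    ext i j
    simp only [rgram, Matrix.mul_apply, of_apply, transpose_apply]
    exact Finset.sum_congr rfl fun c _ => by linear_combination (X i c * X j c) * hs c
  simp only [proj, h1, Matrix.mul_apply, of_apply, transpose_apply, Finset.mul_sum, Finset.sum_mul]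
  exact Finset.sum_congr rfl fun c _ => Finset.sum_congr rfl fun c' _ => by ring

lemma proj_perm {n d : ℕ} (X : Fin n → Fin d → ℝ) (e : Equiv.Perm (Fin d))
    (a b : Fin d) : proj (fun i c => X i (e c)) a b = proj X (e a) (e b) := by
  have h1 : rgram (fun i c => X i (e c)) = rgram X := by
    ext i j
    simp only [rgram, Matrix.mul_apply, of_apply, transpose_apply]
    exact Equiv.sum_comp e (fun c => X i c * X j c)
  simp only [proj, h1, Matrix.mul_apply, of_apply, transpose_apply]

lemma integral_proj_off (n d : ℕ) (a b : Fin d) (hab : a ≠ b) :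
    ∫ X, proj X a b ∂(gm n d) = 0 := by
  let s : Fin d → ℝ := fun c => if c = a then -1 else 1
  have hs : ∀ c, s c * s c = 1 := by intro c; simp only [s]; split_ifs <;> norm_num
  have hg : MeasurePreserving (fun (x : Fin d → ℝ) c => s c * x c) (gv d) (gv d) := by
    refine measurePreserving_pi _ _ fun c => ⟨by fun_prop, ?_⟩
    rw [gaussianReal_map_const_mul]
    congr 1
    · simp
    · ext; simp [pow_two, hs c]
  have h := mp_invariance n d _ hg a b
  simp only [proj_neg _ s hs] at h
  rw [integral_const_mul] at h
  simp [s, hab.symm] at h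
  linarith

lemma integral_proj_diag (n d : ℕ) (hnd : n + 2 ≤ d) (a : Fin d) :
    ∫ X, proj X a a ∂(gm n d) = n / d := by
  have hsame : ∀ b, ∫ X, proj X b b ∂(gm n d) = ∫ X, proj X a a ∂(gm n d) := by
    intro b
    let e := Equiv.swap a b
    have hg : MeasurePreserving (fun (x : Fin d → ℝ) c => x (e c)) (gv d) (gv d) := by
      have := measurePreserving_piCongrLeft (fun _ : Fin d => gaussianReal 0 1) e
      convert this using 1
      ext x c
      obtain ⟨c, rfl⟩ := e.surjective c
      simp [MeasurableEquiv.coe_piCongrLeft, Equiv.piCongrLeft_apply_apply, e]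
    have h := mp_invariance n d _ hg a a
    simp only [proj_perm] at h
    simpa [e] using h
  have h2 : ∫ X, (proj X).trace ∂(gm n d) = n := by
    have : (fun X => (proj X).trace) =ᵐ[gm n d] fun _ => (n:ℝ) := by
      filter_upwards [ae_det n d hnd] with X hX using proj_trace X hX
    rw [integral_congr_ae this]
    simp
  simp only [Matrix.trace, Matrix.diag] at h2
  rw [integral_finsetSum _ (fun b _ => integrable_proj n d hnd b b)] at h2
  simp only [hsame] at h2
  simp at h2
  have : (d:ℝ) ≠ 0 := by
    have : d ≠ 0 := by omega
    exact_mod_cast this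
  field_simp
  linarith

lemma sq_moment_one (v : NNReal) (c : ℝ) :
    Integrable (fun e : ℝ => (c + e) ^ 2) (gaussianReal 0 v) ∧
    ∫ e, (c + e) ^ 2 ∂(gaussianReal 0 v) = v + c ^ 2 := by
  have hm : MemLp (fun e : ℝ => c + e) 2 (gaussianReal 0 v) :=
    (memLp_const c).add (memLp_id_gaussianReal' 2 (by simp))
  refine ⟨hm.integrable_sq, ?_⟩
  have h1 := variance_eq_sub hm
  have h2 : Var[fun e : ℝ => c + e; gaussianReal 0 v] = v := by
    rw [variance_const_add (by fun_prop)]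
    exact variance_fun_id_gaussianReal
  have h3 : ∫ e, (c + e) ∂(gaussianReal 0 v) = c := by
    have hi : Integrable (fun e : ℝ => e) (gaussianReal 0 v) :=
      (memLp_id_gaussianReal' 1 (by simp)).integrable le_rfl
    rw [integral_add (integrable_const _) hi, integral_id_gaussianReal]
    simp
  rw [h2, h3] at h1
  simp only [Pi.pow_apply] at h1
  linarith

lemma sq_moment {m : ℕ} (v : NNReal) (w : Fin m → ℝ) (b : ℝ) :
    Integrable (fun z : Fin m → ℝ => (z ⬝ᵥ w + b) ^ 2) (Measure.pi fun _ : Fin m => gaussianReal 0 v) ∧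
    ∫ z : Fin m → ℝ, (z ⬝ᵥ w + b) ^ 2 ∂(Measure.pi fun _ : Fin m => gaussianReal 0 v) =
      v * (∑ i, w i ^ 2) + b ^ 2 := by
  set μ := (Measure.pi fun _ : Fin m => gaussianReal 0 v)
  have hc1 : ∀ i, MemLp (fun e : ℝ => e * w i) 2 (gaussianReal 0 v) := fun i =>
    (memLp_id_gaussianReal' 2 (by simp)).mul_const (w i)
  have hc : ∀ i, MemLp (fun z : Fin m → ℝ => z i * w i) 2 μ := fun i =>
    (hc1 i).comp_measurePreserving (measurePreserving_eval (fun _ : Fin m => gaussianReal 0 v) i)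
  have hs : MemLp (fun z : Fin m → ℝ => z ⬝ᵥ w) 2 μ := by
    simp only [dotProduct]
    exact memLp_finsetSum _ fun i _ => hc i
  have hm : MemLp (fun z : Fin m → ℝ => z ⬝ᵥ w + b) 2 μ := hs.add (memLp_const b)
  refine ⟨hm.integrable_sq, ?_⟩
  have h1 := variance_eq_sub hm
  have h2 : Var[fun z : Fin m → ℝ => z ⬝ᵥ w + b; μ] = v * (∑ i, w i ^ 2) := by
    rw [variance_add_const hs.aestronglyMeasurable]
    have := variance_sum_pi (μ := fun _ : Fin m => gaussianReal 0 v) (X := fun i e => e * w i) hc1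
    have h4 : (fun z : Fin m → ℝ => z ⬝ᵥ w) = ∑ i, fun z : Fin m → ℝ => z i * w i := by
      ext z; simp [dotProduct]
    rw [h4, this, Finset.mul_sum]
    refine Finset.sum_congr rfl fun i _ => ?_
    rw [variance_mul_const, variance_fun_id_gaussianReal]
  have h3 : ∫ z : Fin m → ℝ, (z ⬝ᵥ w + b) ∂μ = b := by
    rw [integral_add (hs.integrable (by norm_num)) (integrable_const _)]
    simp only [dotProduct]
    rw [integral_finsetSum _ (fun i _ => (hc i).integrable (by norm_num))]
    have : ∀ i, ∫ z : Fin m → ℝ, z i * w i ∂μ = 0 := by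
      intro i
      have h5 := integral_comp_eval (μ := fun _ : Fin m => gaussianReal 0 v) (i := i)
        (f := fun e : ℝ => e * w i) (hc1 i).aestronglyMeasurable
      rw [h5, integral_mul_const, integral_id_gaussianReal, zero_mul]
    simp [this]
  rw [h2, h3] at h1
  simp only [Pi.pow_apply] at h1
  linarith

lemma tonelli4 {A B C D : Type*} [MeasurableSpace A] [MeasurableSpace B] [MeasurableSpace C]
    [MeasurableSpace D] {μ : Measure A} {ν : Measure B} {ρ : Measure C} {τ : Measure D}
    [SFinite μ] [SFinite ν] [SFinite ρ] [SFinite τ]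
    (f : A × B × C × D → ENNReal) (hf : Measurable f) :
    ∫⁻ q, f q ∂(μ.prod (ν.prod (ρ.prod τ))) =
      ∫⁻ a, ∫⁻ b, ∫⁻ c, ∫⁻ d, f (a, b, c, d) ∂τ ∂ρ ∂ν ∂μ := by
  rw [lintegral_prod _ hf.aemeasurable]
  refine lintegral_congr fun a => ?_
  rw [lintegral_prod _ (by fun_prop)]
  refine lintegral_congr fun b => ?_
  rw [lintegral_prod _ (by fun_prop)]

/-- the estimator matrix -/
def Mm {n d : ℕ} (X : Fin n → Fin d → ℝ) : Matrix (Fin d) (Fin n) ℝ := (Matrix.of X)ᵀ * (rgram X)⁻¹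

def rv {n d : ℕ} (β : Fin d → ℝ) (X : Fin n → Fin d → ℝ) (e : Fin n → ℝ) (a : Fin d) : ℝ :=
  e ⬝ᵥ (fun i => - Mm X a i) + ((1 - proj X) *ᵥ β) a

lemma integrand_eq {n d : ℕ} (β : Fin d → ℝ) (X : Fin n → Fin d → ℝ) (e : Fin n → ℝ)
    (x : Fin d → ℝ) (e' : ℝ) :
    (x ⬝ᵥ β + e') - x ⬝ᵥ ((Matrix.of X)ᵀ.mulVec
            ((Matrix.of X * (Matrix.of X)ᵀ)⁻¹.mulVec
              ((Matrix.of X).mulVec β + e))) = x ⬝ᵥ rv β X e + e' := by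
  have h : rv β X e = β - (Matrix.of X)ᵀ.mulVec
            ((Matrix.of X * (Matrix.of X)ᵀ)⁻¹.mulVec
              ((Matrix.of X).mulVec β + e)) := by
    have h1 : (Matrix.of X)ᵀ.mulVec ((Matrix.of X * (Matrix.of X)ᵀ)⁻¹.mulVec
              ((Matrix.of X).mulVec β + e)) = proj X *ᵥ β + Mm X *ᵥ e := by
      rw [proj, Mm, rgram, mulVec_mulVec, mulVec_add, mulVec_mulVec]
    rw [h1]
    ext a
    simp only [rv, sub_mulVec, one_mulVec, Pi.sub_apply, Pi.add_apply]
    have h2 : e ⬝ᵥ (fun i => - Mm X a i) = - (Mm X *ᵥ e) a := by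
      simp [mulVec, dotProduct, mul_comm]
    rw [h2]; ring
  rw [h, dotProduct_sub]; ring

lemma meas_rv {n d : ℕ} (β : Fin d → ℝ) (a : Fin d) :
    Measurable fun p : (Fin n → Fin d → ℝ) × (Fin n → ℝ) => rv β p.1 p.2 a := by
  unfold rv
  simp only [dotProduct, mulVec, Matrix.sub_apply]
  refine Measurable.add (Finset.measurable_sum _ fun i _ => Measurable.mul ?_ (Measurable.neg ?_))
    (Finset.measurable_sum _ fun b _ => Measurable.mul (Measurable.sub measurable_const ?_) measurable_const)
  · exact (measurable_pi_apply i).comp measurable_snd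
  · exact (meas_M a i).comp measurable_fst
  · exact (meas_proj a b).comp measurable_fst

lemma inner_integral {n d : ℕ} (v : NNReal) (β : Fin d → ℝ) (X : Fin n → Fin d → ℝ) :
    ∫⁻ e : Fin n → ℝ, ∫⁻ x : Fin d → ℝ, ∫⁻ e' : ℝ, ENNReal.ofReal ((x ⬝ᵥ rv β X e + e') ^ 2)
      ∂(gaussianReal 0 v) ∂(gv d) ∂(Measure.pi fun _ : Fin n => gaussianReal 0 v) =
    ENNReal.ofReal (v + ∑ a, (v * (∑ i, Mm X a i ^ 2) + ((1 - proj X) *ᵥ β) a ^ 2)) := by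
  have h1 : ∀ c : ℝ, ∫⁻ e' : ℝ, ENNReal.ofReal ((c + e') ^ 2) ∂(gaussianReal 0 v) =
      ENNReal.ofReal (v + c ^ 2) := by
    intro c
    rw [← (sq_moment_one v c).2, ofReal_integral_eq_lintegral_ofReal (sq_moment_one v c).1
      (Filter.Eventually.of_forall fun _ => sq_nonneg _)]
  have h2 : ∀ w : Fin d → ℝ, ∫⁻ x : Fin d → ℝ, ENNReal.ofReal (v + (x ⬝ᵥ w) ^ 2) ∂(gv d) =
      ENNReal.ofReal (v + ∑ a, w a ^ 2) := by
    intro w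
    have h := sq_moment (1 : NNReal) w 0
    simp only [add_zero, NNReal.coe_one, one_mul, ne_eq, OfNat.ofNat_ne_zero, not_false_eq_true,
      zero_pow] at h
    have hI : Integrable (fun x : Fin d → ℝ => (v:ℝ) + (x ⬝ᵥ w) ^ 2) (gv d) :=
      (integrable_const _).add h.1
    rw [← h.2, ← ofReal_integral_eq_lintegral_ofReal hI
      (Filter.Eventually.of_forall fun _ => add_nonneg v.2 (sq_nonneg _)),
      integral_add (integrable_const _) h.1]
    simp
  simp_rw [h1, h2]
  have h3 := fun a => sq_moment v (fun i => - Mm X a i) (((1 - proj X) *ᵥ β) a)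
  unfold rv
  have hi : Integrable (fun e : Fin n → ℝ => ∑ a, (e ⬝ᵥ (fun i => - Mm X a i) + ((1 - proj X) *ᵥ β) a) ^ 2)
      (Measure.pi fun _ : Fin n => gaussianReal 0 v) :=
    integrable_finsetSum _ fun a _ => (h3 a).1
  have hI : Integrable (fun e : Fin n → ℝ => (v:ℝ) + ∑ a, (e ⬝ᵥ (fun i => - Mm X a i) + ((1 - proj X) *ᵥ β) a) ^ 2)
      (Measure.pi fun _ : Fin n => gaussianReal 0 v) := (integrable_const _).add hi
  rw [← ofReal_integral_eq_lintegral_ofReal hI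
      (Filter.Eventually.of_forall fun _ => add_nonneg v.2 (Finset.sum_nonneg fun _ _ => sq_nonneg _)),
      integral_add (integrable_const _) hi, integral_finsetSum _ fun a _ => (h3 a).1]
  simp only [(h3 _).2]
  simp

lemma inner_simplify {n d : ℕ} (v : NNReal) (β : Fin d → ℝ) (X : Fin n → Fin d → ℝ)
    (h : (rgram X).det ≠ 0) :
    v + ∑ a, (v * (∑ i, Mm X a i ^ 2) + ((1 - proj X) *ᵥ β) a ^ 2) =
    v + v * (∑ i, (rgram X)⁻¹ i i) + (∑ a, β a ^ 2 - ∑ a, ∑ b, β a * β b * proj X a b) := by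
  have h1 : ∑ a, ∑ i, Mm X a i ^ 2 = ∑ i, (rgram X)⁻¹ i i := by
    have h2 : (Mm X)ᵀ * Mm X = (rgram X)⁻¹ := by
      rw [Mm, transpose_mul, transpose_transpose, gram_inv_symm, Matrix.mul_assoc,
        ← Matrix.mul_assoc (Matrix.of X), show Matrix.of X * (Matrix.of X)ᵀ = rgram X from rfl,
        Matrix.mul_nonsing_inv _ (isUnit_iff_ne_zero.2 h), Matrix.mul_one]
    rw [← h2, Finset.sum_comm]
    simp only [Matrix.mul_apply, transpose_apply, pow_two]
  have h3 : ∑ a, ((1 - proj X) *ᵥ β) a ^ 2 = β ⬝ᵥ (1 - proj X) *ᵥ β := by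
    have h4 : ∑ a, ((1 - proj X) *ᵥ β) a ^ 2 = ((1 - proj X) *ᵥ β) ⬝ᵥ ((1 - proj X) *ᵥ β) := by
      simp [dotProduct, pow_two]
    have h5 : (1 - proj X)ᵀ = 1 - proj X := by simp [proj_symm]
    rw [h4]
    rw [dotProduct_mulVec, ← mulVec_transpose, h5, mulVec_mulVec, comp_idem X h, dotProduct_comm]
  rw [Finset.sum_add_distrib, ← Finset.mul_sum, h1, h3, sub_mulVec, dotProduct_sub, one_mulVec,
    ← add_assoc]
  congr 2
  · simp [dotProduct, pow_two]
  · simp only [dotProduct, mulVec, Finset.mul_sum]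
    exact Finset.sum_congr rfl fun a _ => Finset.sum_congr rfl fun b _ => by ring

theorem stmt15 (n d₀ : ℕ) (hnd : n + 2 ≤ d₀) (β₀ : Fin d₀ → ℝ) (σ : ℝ) (hσ : 0 < σ) :
    -- joint law of (X, e, x', e'): iid N(0,1) matrix entries; e ~ N(0, σ²Iₙ);
    -- x' ~ N(0, I_{d₀}); e' ~ N(0, σ²); all mutually independent;
    -- β̂ = Xᵀ(XXᵀ)⁻¹y with y = Xβ₀ + e is the minimum norm OLS estimator
    ∫ q : (Fin n → Fin d₀ → ℝ) × (Fin n → ℝ) × (Fin d₀ → ℝ) × ℝ,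
        ((q.2.2.1 ⬝ᵥ β₀ + q.2.2.2) -
          q.2.2.1 ⬝ᵥ ((Matrix.of q.1)ᵀ.mulVec
            ((Matrix.of q.1 * (Matrix.of q.1)ᵀ)⁻¹.mulVec
              ((Matrix.of q.1).mulVec β₀ + q.2.1)))) ^ 2
      ∂((Measure.pi fun _ : Fin n => Measure.pi fun _ : Fin d₀ => gaussianReal 0 1).prod
          ((Measure.pi fun _ : Fin n => gaussianReal 0 ⟨σ ^ 2, sq_nonneg σ⟩).prod
            ((Measure.pi fun _ : Fin d₀ => gaussianReal 0 1).prod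
              (gaussianReal 0 ⟨σ ^ 2, sq_nonneg σ⟩)))) =
    (∑ i, β₀ i ^ 2) * (1 - (n : ℝ) / d₀) +
      σ ^ 2 * (1 + (n : ℝ) / ((d₀ : ℝ) - 1 - n)) := by
  simp_rw [integrand_eq]
  set v : NNReal := ⟨σ ^ 2, sq_nonneg σ⟩ with hv
  have hvσ : (v : ℝ) = σ ^ 2 := rfl
  have hmeas : Measurable fun q : (Fin n → Fin d₀ → ℝ) × (Fin n → ℝ) × (Fin d₀ → ℝ) × ℝ =>
      (q.2.2.1 ⬝ᵥ rv β₀ q.1 q.2.1 + q.2.2.2) ^ 2 := by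
    refine Measurable.pow_const (Measurable.add ?_ ?_) 2
    · simp only [dotProduct]
      refine Finset.measurable_sum _ fun a _ => Measurable.mul ?_ ?_
      · exact (measurable_pi_apply a).comp (by fun_prop)
      · exact (meas_rv β₀ a).comp (measurable_fst.prodMk (measurable_fst.comp measurable_snd))
    · fun_prop
  rw [integral_eq_lintegral_of_nonneg_ae (Filter.Eventually.of_forall fun _ => sq_nonneg _)
    hmeas.aestronglyMeasurable]
  have hm2 := hmeas.ennreal_ofReal
  rw [tonelli4 _ hm2]
  simp only [inner_integral]
  have hae : ∀ᵐ X ∂(gm n d₀),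
      ENNReal.ofReal (v + ∑ a, (v * (∑ i, Mm X a i ^ 2) + ((1 - proj X) *ᵥ β₀) a ^ 2)) =
      ENNReal.ofReal (v + v * (∑ i, (rgram X)⁻¹ i i) +
        (∑ a, β₀ a ^ 2 - ∑ a, ∑ b, β₀ a * β₀ b * proj X a b)) := by
    filter_upwards [ae_det n d₀ hnd] with X hX
    rw [inner_simplify v β₀ X hX]
  rw [lintegral_congr_ae hae]
  have hI1 : Integrable (fun X => v * (∑ i, (rgram X)⁻¹ i i)) (gm n d₀) :=
    (integrable_finsetSum _ fun i _ => (integral_gram_inv n d₀ hnd i).1).const_mul _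
  have hI2 : Integrable (fun X => ∑ a, ∑ b, β₀ a * β₀ b * proj X a b) (gm n d₀) :=
    integrable_finsetSum _ fun a _ => integrable_finsetSum _ fun b _ =>
      (integrable_proj n d₀ hnd a b).const_mul _
  have hI3 : Integrable (fun X => (v:ℝ) + v * (∑ i, (rgram X)⁻¹ i i)) (gm n d₀) :=
    (integrable_const _).add hI1
  have hI4 : Integrable (fun X => ∑ a, β₀ a ^ 2 - ∑ a, ∑ b, β₀ a * β₀ b * proj X a b) (gm n d₀) :=
    (integrable_const _).sub hI2
  have hI5 : Integrable (fun X => (v:ℝ) + v * (∑ i, (rgram X)⁻¹ i i) +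
      (∑ a, β₀ a ^ 2 - ∑ a, ∑ b, β₀ a * β₀ b * proj X a b)) (gm n d₀) := hI3.add hI4
  rw [← integral_eq_lintegral_of_nonneg_ae ?_ hI5.aestronglyMeasurable]
  · rw [integral_add hI3 hI4, integral_add (integrable_const _) hI1,
      integral_sub (integrable_const _) hI2, integral_const_mul,
      integral_finsetSum _ fun i _ => (integral_gram_inv n d₀ hnd i).1,
      integral_finsetSum _ fun a _ => integrable_finsetSum _ fun b _ =>
        (integrable_proj n d₀ hnd a b).const_mul _]
    have hsum : ∀ a, ∫ X, ∑ b, β₀ a * β₀ b * proj X a b ∂(gm n d₀) = β₀ a ^ 2 * (n / d₀) := by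
      intro a
      rw [integral_finsetSum _ fun b _ => (integrable_proj n d₀ hnd a b).const_mul _,
        Finset.sum_eq_single a]
      · rw [integral_const_mul, integral_proj_diag n d₀ hnd]; ring
      · intro b _ hb
        rw [integral_const_mul, integral_proj_off n d₀ a b hb.symm, mul_zero]
      · simp
    simp only [hsum, (integral_gram_inv n d₀ hnd _).2, ← Finset.sum_mul, hvσ]
    simp
    ring
  · filter_upwards [ae_det n d₀ hnd] with X hX
    have := inner_simplify v β₀ X hX
    simp only [Pi.zero_apply]
    rw [← this]
    exact add_nonneg v.2 (Finset.sum_nonneg fun a _ => add_nonneg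
      (mul_nonneg v.2 (Finset.sum_nonneg fun _ _ => sq_nonneg _)) (sq_nonneg _))
end
end
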